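/- Let C and D be abelian categories, let F : D ⥤ C and G : C ⥤ D be functors, and let adj : F ⊣ G be an adjunction. If F is faithful and exact (i.e. F preserves finite limits and finite colimits), then F is comonadic: the comparison functor from D to the category of coalgebras over the comonad T = G ⋙ F (on objects x ↦ F(G x)) induced by the adjunction is an equivalence of categories. -/

import Mathlib

open CategoryTheory

namespace CategoryTheory.Comonad

open Limits

variable {C D : Type*} [Category* C] [Category* D] {F : D ⥤ C} {G : C ⥤ D} (adj : F ⊣ G)

/-- The unit of an adjunction as a fork. -/
abbrev adjUnitFork (X : D) :
    Fork (G.map (F.map (adj.unit.app X))) (adj.unit.app (G.obj (F.obj X))) :=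
  Fork.ofι (adj.unit.app X) (adj.unit_naturality _)

/-- The unit fork is a limit if `F` reflects equalizers. -/
noncomputable def isLimitAdjUnitFork [ReflectsLimitsOfShape WalkingParallelPair F] (X : D) :
    IsLimit (adjUnitFork adj X) :=
  isLimitOfIsLimitForkMap F _ (beckEqualizer ((comparison adj).obj X))

theorem comparison_full [ReflectsLimitsOfShape WalkingParallelPair F] :
    (comparison adj).Full where
  map_surjective {X Y} := by
    rintro ⟨(φ : F.obj X ⟶ F.obj Y), hφ⟩
    replace hφ : F.map (adj.unit.app X) ≫ F.map (G.map φ) = φ ≫ F.map (adj.unit.app Y) := hφ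
    have w : adj.homEquiv _ _ φ ≫ G.map (F.map (adj.unit.app Y)) =
        adj.homEquiv _ _ φ ≫ adj.unit.app (G.obj (F.obj Y)) := by
      rw [← adj.unit_naturality, adj.homEquiv_unit, F.map_comp, hφ, Category.assoc, ← G.map_comp]
    obtain ⟨g, (hg : g ≫ adj.unit.app Y = _)⟩ := Fork.IsLimit.lift' (isLimitAdjUnitFork adj Y) _ w
    refine ⟨g, Coalgebra.Hom.ext ((adj.homEquiv _ _).injective ?_)⟩
    change adj.homEquiv _ _ (F.map g) = adj.homEquiv _ _ φ
    rw [← hg, adj.homEquiv_unit]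
    exact adj.unit_naturality g

theorem comparison_essSurj [HasEqualizers D] [PreservesLimitsOfShape WalkingParallelPair F] :
    (comparison adj).EssSurj where
  mem_essImage A := by
    let e := (isLimitOfHasEqualizerOfPreservesLimit F (G.map A.a)
      (adj.unit.app (G.obj A.A))).conePointUniqueUpToIso (beckEqualizer A)
    have he : e.hom ≫ A.a = F.map (equalizer.ι (G.map A.a) (adj.unit.app (G.obj A.A))) :=
      IsLimit.conePointUniqueUpToIso_hom_comp _ (beckEqualizer A) WalkingParallelPair.zero
    have he' : e.hom = (adj.homEquiv _ _).symm (equalizer.ι _ _) :=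
      (Category.comp_id _).symm.trans <| (congrArg (e.hom ≫ ·) A.counit).symm.trans <|
        (Category.assoc _ _ _).symm.trans <| (congrArg (· ≫ adj.counit.app A.A) he).trans
          (adj.homEquiv_counit _ _ _).symm
    refine ⟨_, ⟨Coalgebra.isoMk e (Eq.trans ?_ he.symm)⟩⟩
    change F.map (adj.unit.app _) ≫ F.map (G.map e.hom) = _
    rw [← F.map_comp, he']
    exact congrArg F.map ((adj.homEquiv_unit _ _ _).symm.trans (Equiv.apply_symm_apply _ _))

/-- The crude comonadicity theorem, with no constraint on universe levels. -/
theorem comparison_isEquivalence [HasEqualizers D] [PreservesLimitsOfShape WalkingParallelPair F]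
    [F.ReflectsIsomorphisms] [F.Faithful] :
    (comparison adj).IsEquivalence where
  faithful := inferInstance
  full :=
    have := reflectsLimitsOfShape_of_reflectsIsomorphisms (G := F) (J := WalkingParallelPair)
    comparison_full adj
  essSurj := comparison_essSurj adj

end CategoryTheory.Comonad

/-- **Barr–Beck theorem.** If `C` and `D` are abelian categories, `adj : F ⊣ G` is an
adjunction with `F : D ⥤ C` faithful and exact (preserving finite limits and finite
colimits), then `F` is comonadic: the comparison functor from `D` to the category of
coalgebras over the comonad `T = G ⋙ F` induced by the adjunction is an equivalence. -/
theorem barr_beck_comonadic {C : Type u₁} {D : Type u₂} [Category.{v₁} C] [Category.{v₂} D]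
    [Abelian C] [Abelian D] (F : D ⥤ C) (G : C ⥤ D) (adj : F ⊣ G)
    [F.Faithful] [Limits.PreservesFiniteLimits F] [Limits.PreservesFiniteColimits F] :
    (Comonad.comparison adj).IsEquivalence := by
  exact Comonad.comparison_isEquivalence adj
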